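/- arXiv:2407.09845 — 10 statements merged into one kernel-verified Lean document; each statement's English description precedes it below -/
import Mathlib

section
/- Let η_a, η_b ≥ 0 and σ, λ ∈ ℝ, and let a, b : ℝ → ℝ be differentiable functions satisfying a'(t) = η_a · b(t) · (σ − λ · a(t) · b(t)) and b'(t) = η_b · a(t) · (σ − λ · a(t) · b(t)) for all t. Set γ := η_b · a(0)² − η_a · b(0)² and η := √(η_a · η_b). Then z(t) := a(t) · b(t) satisfies the bridged gradient flow z'(t) = √(γ² + 4η² · z(t)²) · (σ − λ · z(t)) for all t. -/
/-- The bridged gradient flow: with `γ = η_b·a(0)² − η_a·b(0)²` and `η = √(η_a·η_b)`,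
the product `z = a·b` satisfies `z' = √(γ² + 4η²z²)·(σ − λz)`. -/
theorem stmt_2 (ηa ηb σ lam : ℝ) (hηa : 0 ≤ ηa) (hηb : 0 ≤ ηb)
    (a b : ℝ → ℝ) (hda : Differentiable ℝ a) (hdb : Differentiable ℝ b)
    (ha : ∀ t, deriv a t = ηa * b t * (σ - lam * a t * b t))
    (hb : ∀ t, deriv b t = ηb * a t * (σ - lam * a t * b t))
    (γ η : ℝ) (hγ : γ = ηb * a 0 ^ 2 - ηa * b 0 ^ 2)
    (hη : η = Real.sqrt (ηa * ηb)) :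
    ∀ t, deriv (fun s => a s * b s) t
      = Real.sqrt (γ ^ 2 + 4 * η ^ 2 * (a t * b t) ^ 2) * (σ - lam * (a t * b t)) := by
  intro t
  have hA : ∀ s, HasDerivAt a (ηa * b s * (σ - lam * a s * b s)) s := fun s => by
    rw [← ha s]; exact (hda s).hasDerivAt
  have hB : ∀ s, HasDerivAt b (ηb * a s * (σ - lam * a s * b s)) s := fun s => by
    rw [← hb s]; exact (hdb s).hasDerivAt
  have hC : ∀ s, HasDerivAt (fun s => ηb * a s ^ 2 - ηa * b s ^ 2) 0 s := fun s => by
    have h := (((hA s).pow 2).const_mul ηb).sub (((hB s).pow 2).const_mul ηa)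
    refine h.congr_deriv ?_
    push_cast
    ring
  have hcons : ηb * a t ^ 2 - ηa * b t ^ 2 = γ := by
    rw [hγ]
    exact is_const_of_deriv_eq_zero (fun s => (hC s).differentiableAt)
      (fun s => (hC s).deriv) t 0
  have hsq : η ^ 2 = ηa * ηb := by
    rw [hη, Real.sq_sqrt (mul_nonneg hηa hηb)]
  have hroot : Real.sqrt (γ ^ 2 + 4 * η ^ 2 * (a t * b t) ^ 2)
      = ηb * a t ^ 2 + ηa * b t ^ 2 := by
    rw [hsq, ← hcons, ← Real.sqrt_sq (show 0 ≤ ηb * a t ^ 2 + ηa * b t ^ 2 by positivity)]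
    congr 1
    ring
  rw [hroot, ((hA t).fun_mul (hB t)).deriv]
  ring
end

section
/- Let λ > 0, σ ≥ 0, η ≥ 0, γ ≠ 0, z₀ < σ/λ, and set μ := √(γ²λ² + 4η²σ²) and C := (√((γ²λ² + 4η²σ²)(γ² + 4η²z₀²)) + γ²λ + 4η²σz₀) / (λ(σ − λz₀)). Define z : ℝ → ℝ by z(t) = (C²λ²σ·e^{2μt} − 2Cγ²λ²·e^{μt} − 4γ²η²σ) / (λ·(C²λ²·e^{2μt} + 8Cη²σ·e^{μt} − 4γ²η²)). Then z(0) = z₀ and z is a solution of the bridged gradient flow: z'(t) = √(γ² + 4η²z(t)²)·(σ − λz(t)) for all t ≥ 0. -/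
/-- The explicit formula solves the bridged gradient flow
`z' = √(γ² + 4η²z²)·(σ − λz)` with initial value `z₀ < σ/λ`, for `γ ≠ 0`. -/
theorem stmt_3 (lam σ η γ z₀ μ C : ℝ) (hlam : 0 < lam) (hσ : 0 ≤ σ) (hη : 0 ≤ η)
    (hγ : γ ≠ 0) (hz₀ : z₀ < σ / lam)
    (hμ : μ = Real.sqrt (γ ^ 2 * lam ^ 2 + 4 * η ^ 2 * σ ^ 2))
    (hC : C = (Real.sqrt ((γ ^ 2 * lam ^ 2 + 4 * η ^ 2 * σ ^ 2)
          * (γ ^ 2 + 4 * η ^ 2 * z₀ ^ 2))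
        + γ ^ 2 * lam + 4 * η ^ 2 * σ * z₀) / (lam * (σ - lam * z₀)))
    (z : ℝ → ℝ)
    (hz : ∀ t, z t = (C ^ 2 * lam ^ 2 * σ * Real.exp (2 * μ * t)
        - 2 * C * γ ^ 2 * lam ^ 2 * Real.exp (μ * t) - 4 * γ ^ 2 * η ^ 2 * σ)
      / (lam * (C ^ 2 * lam ^ 2 * Real.exp (2 * μ * t)
        + 8 * C * η ^ 2 * σ * Real.exp (μ * t) - 4 * γ ^ 2 * η ^ 2))) :
    z 0 = z₀ ∧
      ∀ t ≥ (0 : ℝ),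
        HasDerivAt z (Real.sqrt (γ ^ 2 + 4 * η ^ 2 * z t ^ 2) * (σ - lam * z t)) t := by
  have hd : 0 < σ - lam * z₀ := by
    have := (lt_div_iff₀ hlam).1 hz₀
    linarith
  have hγ2 : 0 < γ ^ 2 := by positivity
  have hM : 0 < γ ^ 2 * lam ^ 2 + 4 * η ^ 2 * σ ^ 2 := by positivity
  have hμpos : 0 < μ := by rw [hμ]; exact Real.sqrt_pos.2 hM
  have hμ2 : μ ^ 2 = γ ^ 2 * lam ^ 2 + 4 * η ^ 2 * σ ^ 2 := by
    rw [hμ]; exact Real.sq_sqrt hM.le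
  obtain ⟨q, hq⟩ : ∃ q, q = Real.sqrt ((γ ^ 2 * lam ^ 2 + 4 * η ^ 2 * σ ^ 2)
          * (γ ^ 2 + 4 * η ^ 2 * z₀ ^ 2)) := ⟨_, rfl⟩
  have hq0 : 0 < q := by rw [hq]; exact Real.sqrt_pos.2 (by positivity)
  have hq2 : q ^ 2 = (γ ^ 2 * lam + 4 * η ^ 2 * σ * z₀) ^ 2
      + 4 * η ^ 2 * γ ^ 2 * (σ - lam * z₀) ^ 2 := by
    rw [hq, Real.sq_sqrt (by positivity)]; ring
  rw [← hq] at hC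
  have hCd : C * lam * (σ - lam * z₀) = q + γ ^ 2 * lam + 4 * η ^ 2 * σ * z₀ := by
    rw [hC]; field_simp
  have hqp : 0 < q + γ ^ 2 * lam + 4 * η ^ 2 * σ * z₀ := by
    rcases hη.eq_or_lt with h | h
    · rw [← h]; have : 0 < γ ^ 2 * lam := by positivity
      nlinarith
    · have h1 : 0 < 4 * η ^ 2 * γ ^ 2 * (σ - lam * z₀) ^ 2 := by positivity
      have h2 : |γ ^ 2 * lam + 4 * η ^ 2 * σ * z₀| < q :=
        abs_lt_of_sq_lt_sq (by linarith) hq0.le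
      have := (abs_lt.1 h2).1
      linarith
  obtain ⟨x₀, hx₀⟩ : ∃ x₀, x₀ = C * lam := ⟨_, rfl⟩
  rw [← hx₀] at hCd
  have hx₀pos : 0 < x₀ := by
    by_contra h
    have := mul_nonneg (sub_nonneg.2 (not_lt.1 h)) hd.le
    nlinarith
  have hquad : x₀ ^ 2 * (σ - lam * z₀) - 2 * (γ ^ 2 * lam + 4 * η ^ 2 * σ * z₀) * x₀
      - 4 * η ^ 2 * γ ^ 2 * (σ - lam * z₀) = 0 := by
    have hqe : q = x₀ * (σ - lam * z₀) - (γ ^ 2 * lam + 4 * η ^ 2 * σ * z₀) := by linarith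
    rw [hqe] at hq2
    apply mul_left_cancel₀ hd.ne'
    linear_combination hq2
  have hD0 : (σ - lam * z₀) * (lam * x₀ ^ 2 + 8 * η ^ 2 * σ * x₀ - 4 * η ^ 2 * γ ^ 2 * lam)
      = 2 * x₀ * μ ^ 2 := by
    rw [hμ2]; linear_combination lam * hquad
  have hD0pos : 0 < lam * x₀ ^ 2 + 8 * η ^ 2 * σ * x₀ - 4 * η ^ 2 * γ ^ 2 * lam := by
    have : 0 < (σ - lam * z₀) *
        (lam * x₀ ^ 2 + 8 * η ^ 2 * σ * x₀ - 4 * η ^ 2 * γ ^ 2 * lam) := by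
      rw [hD0]; positivity
    exact (pos_iff_pos_of_mul_pos this).1 hd
  -- the simplified formula
  have hz' : ∀ t, z t = (σ * (x₀ * Real.exp (μ * t)) ^ 2
      - 2 * γ ^ 2 * lam * (x₀ * Real.exp (μ * t)) - 4 * γ ^ 2 * η ^ 2 * σ)
      / (lam * (x₀ * Real.exp (μ * t)) ^ 2 + 8 * η ^ 2 * σ * (x₀ * Real.exp (μ * t))
        - 4 * η ^ 2 * γ ^ 2 * lam) := by
    intro t
    have he : Real.exp (2 * μ * t) = Real.exp (μ * t) ^ 2 := by
      rw [← Real.exp_nat_mul]; congr 1; push_cast; ring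
    rw [hz t, he, hx₀]
    congr 1 <;> ring
  refine ⟨?_, ?_⟩
  · rw [hz' 0, mul_zero, Real.exp_zero, mul_one, div_eq_iff hD0pos.ne']
    apply mul_left_cancel₀ hlam.ne'
    rw [hμ2] at hD0
    linear_combination hD0
  · intro t ht
    have hE : 1 ≤ Real.exp (μ * t) := Real.one_le_exp (by positivity)
    have hder : HasDerivAt (fun s => x₀ * Real.exp (μ * s)) (μ * (x₀ * Real.exp (μ * t))) t := by
      have h1 : HasDerivAt (fun s : ℝ => μ * s) μ t := by
        simpa using (hasDerivAt_id t).const_mul μ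
      exact (h1.exp.const_mul x₀).congr_deriv (by ring)
    have hzt := hz' t
    have hxx : x₀ ≤ x₀ * Real.exp (μ * t) := by nlinarith
    obtain ⟨X, hX⟩ : ∃ X : ℝ → ℝ, X = fun s => x₀ * Real.exp (μ * s) := ⟨_, rfl⟩
    have hXs : ∀ s, x₀ * Real.exp (μ * s) = X s := fun s => by rw [hX]
    simp only [hXs] at hz' hzt hxx hder
    have hXpos : 0 < X t := by linarith
    have hD : 0 < lam * X t ^ 2 + 8 * η ^ 2 * σ * X t - 4 * η ^ 2 * γ ^ 2 * lam := by
      have h1 : lam * x₀ ^ 2 ≤ lam * X t ^ 2 := by gcongr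
      have h2 : 8 * η ^ 2 * σ * x₀ ≤ 8 * η ^ 2 * σ * X t := by gcongr
      linarith
    have hsq : Real.sqrt (γ ^ 2 + 4 * η ^ 2 * z t ^ 2) = μ * (X t ^ 2 + 4 * η ^ 2 * γ ^ 2)
        / (lam * X t ^ 2 + 8 * η ^ 2 * σ * X t - 4 * η ^ 2 * γ ^ 2 * lam) := by
      have key : γ ^ 2 + 4 * η ^ 2 * z t ^ 2 = (μ * (X t ^ 2 + 4 * η ^ 2 * γ ^ 2)
        / (lam * X t ^ 2 + 8 * η ^ 2 * σ * X t - 4 * η ^ 2 * γ ^ 2 * lam)) ^ 2 := by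
        rw [hzt, div_pow, div_pow, eq_div_iff (pow_ne_zero 2 hD.ne'), add_mul, mul_assoc (4 * η ^ 2) (_ / _),
          div_mul_cancel₀ _ (pow_ne_zero 2 hD.ne')]
        linear_combination (-(X t ^ 2 + 4 * η ^ 2 * γ ^ 2) ^ 2) * hμ2
      rw [key, Real.sqrt_sq (by positivity)]
    have hlin : σ - lam * z t = 2 * X t * μ ^ 2
        / (lam * X t ^ 2 + 8 * η ^ 2 * σ * X t - 4 * η ^ 2 * γ ^ 2 * lam) := by
      rw [eq_div_iff hD.ne', hzt, sub_mul, ← mul_div_assoc, div_mul_cancel₀ _ hD.ne', hμ2]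
      ring
    rw [hsq, hlin]
    have hN : HasDerivAt (fun s => σ * X s ^ 2 - 2 * γ ^ 2 * lam * X s - 4 * γ ^ 2 * η ^ 2 * σ)
        (σ * (2 * X t * (μ * X t)) - 2 * γ ^ 2 * lam * (μ * X t)) t := by
      have := (((hder.pow 2).const_mul σ).sub (hder.const_mul (2 * γ ^ 2 * lam))).sub_const
        (4 * γ ^ 2 * η ^ 2 * σ)
      exact this.congr_deriv (by simp)
    have hDd : HasDerivAt (fun s => lam * X s ^ 2 + 8 * η ^ 2 * σ * X s - 4 * η ^ 2 * γ ^ 2 * lam)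
        (lam * (2 * X t * (μ * X t)) + 8 * η ^ 2 * σ * (μ * X t)) t := by
      have := (((hder.pow 2).const_mul lam).add (hder.const_mul (8 * η ^ 2 * σ))).sub_const
        (4 * η ^ 2 * γ ^ 2 * lam)
      exact this.congr_deriv (by simp)
    have hfin := hN.div hDd hD.ne'
    have hzf : z = (fun s => σ * X s ^ 2 - 2 * γ ^ 2 * lam * X s - 4 * γ ^ 2 * η ^ 2 * σ) /
        (fun s => lam * X s ^ 2 + 8 * η ^ 2 * σ * X s - 4 * η ^ 2 * γ ^ 2 * lam) := by
      funext s; exact hz' s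
    rw [hzf]
    refine hfin.congr_deriv (Eq.symm ?_)
    rw [div_mul_div_comm, ← sq]
    congr 1
    linear_combination (2 * μ * X t * (X t ^ 2 + 4 * η ^ 2 * γ ^ 2)) * hμ2
end

section
/- Let λ > 0, σ ≥ 0, η ≥ 0, γ ≠ 0, z₀ < σ/λ, and let z : ℝ → ℝ be the explicit function z(t) = (C²λ²σ·e^{2μt} − 2Cγ²λ²·e^{μt} − 4γ²η²σ) / (λ·(C²λ²·e^{2μt} + 8Cη²σ·e^{μt} − 4γ²η²)) with μ := √(γ²λ² + 4η²σ²) and C := (√((γ²λ² + 4η²σ²)(γ² + 4η²z₀²)) + γ²λ + 4η²σz₀)/(λ(σ − λz₀)). Then z(t) → σ/λ as t → ∞. -/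
/-- The explicit solution of the bridged gradient flow converges to `σ/λ` as `t → ∞`. -/
theorem stmt_4 (lam σ η γ z₀ μ C : ℝ) (hlam : 0 < lam) (hσ : 0 ≤ σ) (hη : 0 ≤ η)
    (hγ : γ ≠ 0) (hz₀ : z₀ < σ / lam)
    (hμ : μ = Real.sqrt (γ ^ 2 * lam ^ 2 + 4 * η ^ 2 * σ ^ 2))
    (hC : C = (Real.sqrt ((γ ^ 2 * lam ^ 2 + 4 * η ^ 2 * σ ^ 2)
          * (γ ^ 2 + 4 * η ^ 2 * z₀ ^ 2))
        + γ ^ 2 * lam + 4 * η ^ 2 * σ * z₀) / (lam * (σ - lam * z₀)))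
    (z : ℝ → ℝ)
    (hz : ∀ t, z t = (C ^ 2 * lam ^ 2 * σ * Real.exp (2 * μ * t)
        - 2 * C * γ ^ 2 * lam ^ 2 * Real.exp (μ * t) - 4 * γ ^ 2 * η ^ 2 * σ)
      / (lam * (C ^ 2 * lam ^ 2 * Real.exp (2 * μ * t)
        + 8 * C * η ^ 2 * σ * Real.exp (μ * t) - 4 * γ ^ 2 * η ^ 2))) :
    Filter.Tendsto z Filter.atTop (nhds (σ / lam)) := by
  have hd : 0 < σ - lam * z₀ := by
    rw [lt_div_iff₀ hlam] at hz₀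
    linarith
  have hg : 0 < γ ^ 2 := by positivity
  have hμ0 : 0 < μ := by
    rw [hμ]
    apply Real.sqrt_pos.2
    positivity
  have hnum : 0 < Real.sqrt ((γ ^ 2 * lam ^ 2 + 4 * η ^ 2 * σ ^ 2)
          * (γ ^ 2 + 4 * η ^ 2 * z₀ ^ 2)) + (γ ^ 2 * lam + 4 * η ^ 2 * σ * z₀) := by
    rcases lt_or_ge 0 (γ ^ 2 * lam + 4 * η ^ 2 * σ * z₀) with h | h
    · exact add_pos_of_nonneg_of_pos (Real.sqrt_nonneg _) h
    · have hη0 : η ≠ 0 := by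
        rintro rfl
        have : 0 < γ ^ 2 * lam := by positivity
        nlinarith
      have hp : 0 < 4 * η ^ 2 * γ ^ 2 * (σ - lam * z₀) ^ 2 := by positivity
      have : -(γ ^ 2 * lam + 4 * η ^ 2 * σ * z₀) < Real.sqrt ((γ ^ 2 * lam ^ 2 + 4 * η ^ 2 * σ ^ 2)
          * (γ ^ 2 + 4 * η ^ 2 * z₀ ^ 2)) := by
        apply Real.lt_sqrt_of_sq_lt
        linear_combination hp
      linarith
  have hC0 : 0 < C := by
    rw [hC, add_assoc]
    positivity
  have hE : Filter.Tendsto (fun t : ℝ => Real.exp (-(μ * t))) Filter.atTop (nhds 0) :=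
    Real.tendsto_exp_neg_atTop_nhds_zero.comp (Filter.tendsto_id.const_mul_atTop hμ0)
  have hcont : ContinuousAt (fun x : ℝ => (C ^ 2 * lam ^ 2 * σ
        - 2 * C * γ ^ 2 * lam ^ 2 * x - 4 * γ ^ 2 * η ^ 2 * σ * x ^ 2)
      / (lam * (C ^ 2 * lam ^ 2
        + 8 * C * η ^ 2 * σ * x - 4 * γ ^ 2 * η ^ 2 * x ^ 2))) 0 := by
    apply ContinuousAt.div
    · fun_prop
    · fun_prop
    · have : lam * (C ^ 2 * lam ^ 2) ≠ 0 := by positivity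
      simpa using this
  have hlim := hcont.tendsto.comp hE
  have hval : (C ^ 2 * lam ^ 2 * σ
        - 2 * C * γ ^ 2 * lam ^ 2 * 0 - 4 * γ ^ 2 * η ^ 2 * σ * 0 ^ 2)
      / (lam * (C ^ 2 * lam ^ 2
        + 8 * C * η ^ 2 * σ * 0 - 4 * γ ^ 2 * η ^ 2 * 0 ^ 2)) = σ / lam := by
    have := hC0.ne'
    have := hlam.ne'
    simp
    field_simp
  rw [hval] at hlim
  refine hlim.congr fun t => ?_
  rw [hz t]
  simp only [Function.comp]
  have h2 : Real.exp (2 * μ * t) = Real.exp (μ * t) ^ 2 := by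
    rw [← Real.exp_nat_mul]
    congr 1
    push_cast
    ring
  have hy : Real.exp (μ * t) ≠ 0 := (Real.exp_pos _).ne'
  rw [h2, Real.exp_neg]
  generalize Real.exp (μ * t) = y at hy
  rw [← mul_div_mul_right _ _ (pow_ne_zero 2 hy)]
  congr 1 <;> field_simp
end

section
/- Let λ > 0, σ ≥ 0, η ≥ 0, γ ≠ 0, z₀ < σ/λ, and let z : ℝ → ℝ be the function z(t) = (C²λ²σ·e^{2μt} − 2Cγ²λ²·e^{μt} − 4γ²η²σ) / (λ·(C²λ²·e^{2μt} + 8Cη²σ·e^{μt} − 4γ²η²)) with μ := √(γ²λ² + 4η²σ²) and C := (√((γ²λ² + 4η²σ²)(γ² + 4η²z₀²)) + γ²λ + 4η²σz₀)/(λ(σ − λz₀)). Then there exists a constant K ≥ 0 such that |σ/λ − z(t)| ≤ K·e^{−μt} for all t ≥ 0; i.e., z converges to σ/λ at rate O(e^{−√(γ²λ² + 4η²σ²)·t}). -/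
/-- The explicit solution of the bridged gradient flow converges to `σ/λ` at rate
`O(e^{−μt})` with `μ = √(γ²λ² + 4η²σ²)`. -/
theorem stmt_5 (lam σ η γ z₀ μ C : ℝ) (hlam : 0 < lam) (hσ : 0 ≤ σ) (hη : 0 ≤ η)
    (hγ : γ ≠ 0) (hz₀ : z₀ < σ / lam)
    (hμ : μ = Real.sqrt (γ ^ 2 * lam ^ 2 + 4 * η ^ 2 * σ ^ 2))
    (hC : C = (Real.sqrt ((γ ^ 2 * lam ^ 2 + 4 * η ^ 2 * σ ^ 2)
          * (γ ^ 2 + 4 * η ^ 2 * z₀ ^ 2))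
        + γ ^ 2 * lam + 4 * η ^ 2 * σ * z₀) / (lam * (σ - lam * z₀)))
    (z : ℝ → ℝ)
    (hz : ∀ t, z t = (C ^ 2 * lam ^ 2 * σ * Real.exp (2 * μ * t)
        - 2 * C * γ ^ 2 * lam ^ 2 * Real.exp (μ * t) - 4 * γ ^ 2 * η ^ 2 * σ)
      / (lam * (C ^ 2 * lam ^ 2 * Real.exp (2 * μ * t)
        + 8 * C * η ^ 2 * σ * Real.exp (μ * t) - 4 * γ ^ 2 * η ^ 2))) :
    ∃ K : ℝ, 0 ≤ K ∧ ∀ t ≥ (0 : ℝ), |σ / lam - z t| ≤ K * Real.exp (-μ * t) := by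
  have hγ2 : 0 < γ ^ 2 := by positivity
  have hg : 0 < σ - lam * z₀ := by
    rw [lt_div_iff₀ hlam] at hz₀
    linarith
  set M := γ ^ 2 * lam ^ 2 + 4 * η ^ 2 * σ ^ 2 with hM
  have hMpos : 0 < M := by positivity
  set S := Real.sqrt (M * (γ ^ 2 + 4 * η ^ 2 * z₀ ^ 2)) with hS
  have hS0 : 0 ≤ S := Real.sqrt_nonneg _
  have hS2 : S ^ 2 = M * (γ ^ 2 + 4 * η ^ 2 * z₀ ^ 2) := Real.sq_sqrt (by positivity)
  have hSP : S ^ 2 - (γ ^ 2 * lam + 4 * η ^ 2 * σ * z₀) ^ 2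
      = 4 * η ^ 2 * γ ^ 2 * (σ - lam * z₀) ^ 2 := by
    rw [hS2, hM]; ring
  have hR : 0 < lam * (σ - lam * z₀) := by positivity
  have hCR : C * (lam * (σ - lam * z₀)) = S + (γ ^ 2 * lam + 4 * η ^ 2 * σ * z₀) := by
    rw [hC, div_mul_cancel₀ _ hR.ne']; ring
  have hnum : 0 < S + (γ ^ 2 * lam + 4 * η ^ 2 * σ * z₀) := by
    rcases hη.eq_or_lt with h | h
    · have : 0 < γ ^ 2 * lam := by positivity
      rw [← h]; nlinarith
    · have h1 : 0 < 4 * η ^ 2 * γ ^ 2 * (σ - lam * z₀) ^ 2 := by positivity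
      have h2 : |γ ^ 2 * lam + 4 * η ^ 2 * σ * z₀| < S := abs_lt_of_sq_lt_sq (by linarith) hS0
      linarith [(abs_lt.1 h2).1]
  have hCpos : 0 < C := by
    rw [← hCR] at hnum
    exact pos_of_mul_pos_left hnum hR.le
  have hd : 0 < C ^ 2 * lam ^ 2 + 8 * C * η ^ 2 * σ - 4 * γ ^ 2 * η ^ 2 := by
    have hSe : S = C * (lam * (σ - lam * z₀)) - (γ ^ 2 * lam + 4 * η ^ 2 * σ * z₀) := by
      linarith
    have h1 : (σ - lam * z₀) * ((C ^ 2 * lam ^ 2 + 8 * C * η ^ 2 * σ - 4 * γ ^ 2 * η ^ 2)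
        * (σ - lam * z₀)) = (σ - lam * z₀) * (2 * C * M) := by
      rw [hSe] at hSP
      rw [hM]
      linear_combination hSP
    have h2 := mul_left_cancel₀ hg.ne' h1
    have h3 : 0 < 2 * C * M := by positivity
    rw [← h2] at h3
    exact pos_of_mul_pos_left h3 hg.le
  obtain ⟨k, hk, hkA, hkd⟩ : ∃ k : ℝ, 0 < k ∧ k ≤ C ^ 2 * lam ^ 2 ∧
      k ≤ C ^ 2 * lam ^ 2 + 8 * C * η ^ 2 * σ - 4 * γ ^ 2 * η ^ 2 :=
    ⟨min _ _, lt_min (by positivity) hd, min_le_left _ _, min_le_right _ _⟩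
  have hμ0 : 0 ≤ μ := hμ ▸ Real.sqrt_nonneg _
  refine ⟨2 * C * M / (lam * k), by positivity, fun t ht => ?_⟩
  rw [hz t]
  have hE2 : Real.exp (2 * μ * t) = Real.exp (μ * t) ^ 2 := by
    rw [← Real.exp_nat_mul]; congr 1; push_cast; ring
  have hEn : Real.exp (-μ * t) = (Real.exp (μ * t))⁻¹ := by
    rw [← Real.exp_neg]; congr 1; ring
  have hE1 : 1 ≤ Real.exp (μ * t) := Real.one_le_exp (by positivity)
  rw [hE2, hEn]
  generalize Real.exp (μ * t) = E at hE1
  have hE0 : 0 < E := by linarith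
  have hD : k * E ^ 2 ≤ C ^ 2 * lam ^ 2 * E ^ 2 + 8 * C * η ^ 2 * σ * E
      - 4 * γ ^ 2 * η ^ 2 := by
    have h1 : 0 ≤ (C ^ 2 * lam ^ 2 - k) * (E * (E - 1)) :=
      mul_nonneg (by linarith) (mul_nonneg hE0.le (by linarith))
    have h2 : 0 ≤ (C ^ 2 * lam ^ 2 + 8 * C * η ^ 2 * σ - 4 * γ ^ 2 * η ^ 2 - k) * E :=
      mul_nonneg (by linarith) hE0.le
    have h3 : 0 ≤ 4 * γ ^ 2 * η ^ 2 * (E - 1) :=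
      mul_nonneg (by positivity) (by linarith)
    linarith
  have hkE : 0 < k * E ^ 2 := by positivity
  generalize hDD : C ^ 2 * lam ^ 2 * E ^ 2 + 8 * C * η ^ 2 * σ * E
      - 4 * γ ^ 2 * η ^ 2 = D at hD
  have hD0 : 0 < D := by linarith
  have heq : σ / lam - (C ^ 2 * lam ^ 2 * σ * E ^ 2 - 2 * C * γ ^ 2 * lam ^ 2 * E
      - 4 * γ ^ 2 * η ^ 2 * σ) / (lam * D) = 2 * C * M * E / (lam * D) := by
    rw [div_sub_div _ _ hlam.ne' (by positivity), div_eq_div_iff (by positivity) (by positivity),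
      hM, ← hDD]
    ring
  have heq2 : 2 * C * M / (lam * k) * E⁻¹ = 2 * C * M * E / (lam * (k * E ^ 2)) := by
    field_simp
  rw [heq, heq2, abs_of_nonneg (by positivity)]
  gcongr
end

section
/- Let λ > 0, σ ≥ 0, η ≥ 0, γ ∈ ℝ, z̄ ∈ ℝ, and let z : ℝ → ℝ be differentiable with z'(t) = √(γ² + 4η²z(t)²)·(σ − λz(t)) for all t ≥ 0 and z(0) < σ/λ. Define L(t) := λ·(z̄ − z(t))². Then for all 0 ≤ s ≤ t: if z(t) ≤ z̄ then L(s) ≥ L(t), and if z(s) ≥ z̄ then L(s) ≤ L(t). In particular, the generalisation curve L is either monotonically decreasing, U-shaped, or monotonically increasing on [0, ∞). -/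
/-- Monotonicity structure of the per-weight generalisation curve
`L(t) = λ(z̄ − z(t))²` along the bridged gradient flow: it is decreasing while the
weight is below the true weight `z̄`, and increasing after the true weight is passed;
hence `L` is monotonically decreasing, U-shaped, or monotonically increasing. -/
theorem stmt_11 (lam σ η γ zbar : ℝ) (hlam : 0 < lam) (hσ : 0 ≤ σ) (hη : 0 ≤ η)
    (z : ℝ → ℝ)
    (hz : ∀ t ≥ (0 : ℝ),
      HasDerivAt z (Real.sqrt (γ ^ 2 + 4 * η ^ 2 * z t ^ 2) * (σ - lam * z t)) t)
    (hz0 : z 0 < σ / lam)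
    (L : ℝ → ℝ) (hL : ∀ t, L t = lam * (zbar - z t) ^ 2) :
    ∀ s t : ℝ, 0 ≤ s → s ≤ t →
      (z t ≤ zbar → L t ≤ L s) ∧ (zbar ≤ z s → L s ≤ L t) := by
  have hcont : ContinuousOn z (Set.Ici 0) := fun t ht =>
    (hz t ht).continuousAt.continuousWithinAt
  have hanti : AntitoneOn (fun t => (σ - lam * z t) ^ 2) (Set.Ici 0) := by
    have hd : ∀ t ≥ (0 : ℝ), HasDerivAt (fun t => (σ - lam * z t) ^ 2)
        (-(2 * lam * Real.sqrt (γ ^ 2 + 4 * η ^ 2 * z t ^ 2) * (σ - lam * z t) ^ 2)) t := by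
      intro t ht
      have h := (((hz t ht).const_mul lam).const_sub σ).pow 2
      refine h.congr_deriv ?_
      push_cast
      ring
    refine antitoneOn_of_deriv_nonpos (convex_Ici 0)
      (fun t ht => (hd t ht).continuousAt.continuousWithinAt) ?_ ?_
    · intro t ht
      rw [interior_Ici] at ht
      exact (hd t (le_of_lt ht)).differentiableAt.differentiableWithinAt
    · intro t ht
      rw [interior_Ici] at ht
      rw [(hd t (le_of_lt ht)).deriv]
      have : 0 ≤ 2 * lam * Real.sqrt (γ ^ 2 + 4 * η ^ 2 * z t ^ 2) * (σ - lam * z t) ^ 2 := by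
        positivity
      linarith
  have h0 : 0 < σ - lam * z 0 := by
    rw [lt_div_iff₀ hlam] at hz0
    linarith
  have hnn : ∀ t ≥ (0 : ℝ), 0 ≤ σ - lam * z t := by
    intro t ht
    by_contra hneg
    push Not at hneg
    have hc : ContinuousOn (fun t => σ - lam * z t) (Set.Icc 0 t) :=
      continuousOn_const.sub
        (continuousOn_const.mul (hcont.mono Set.Icc_subset_Ici_self))
    obtain ⟨r, hr, hr0⟩ := intermediate_value_Icc' ht hc ⟨hneg.le, h0.le⟩
    have h := hanti (Set.mem_Ici.2 hr.1) (Set.mem_Ici.2 ht) hr.2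
    simp only at h hr0
    rw [hr0] at h
    nlinarith
  have hmono : MonotoneOn z (Set.Ici 0) := by
    refine monotoneOn_of_deriv_nonneg (convex_Ici 0) hcont ?_ ?_
    · intro t ht
      rw [interior_Ici] at ht
      exact (hz t (le_of_lt ht)).differentiableAt.differentiableWithinAt
    · intro t ht
      rw [interior_Ici] at ht
      rw [(hz t (le_of_lt ht)).deriv]
      exact mul_nonneg (Real.sqrt_nonneg _) (hnn t (le_of_lt ht))
  intro s t hs hst
  have hzst : z s ≤ z t := hmono (Set.mem_Ici.2 hs) (Set.mem_Ici.2 (hs.trans hst)) hst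
  rw [hL, hL]
  constructor
  · intro h
    apply mul_le_mul_of_nonneg_left _ hlam.le
    nlinarith
  · intro h
    apply mul_le_mul_of_nonneg_left _ hlam.le
    nlinarith
end

section
/- Let λ > 0, σ > 0, η ≥ 0, γ ∈ ℝ, ρ ∈ (0, 1], and set z̄ := (1 − ρ)·σ/λ. Let z : ℝ → ℝ be twice differentiable with z'(t) = √(γ² + 4η²z(t)²)·(σ − λz(t)) for all t, and define L(t) := λ·(z̄ − z(t))². If t₀ is a time with z(t₀) = z̄, then L''(t₀) = 2ρ²σ²·(γ²λ² + 4η²σ²(1 − ρ)²)/λ. In particular, if moreover γ²λ² + 4η²σ²(1 − ρ)² > 0, then L''(t₀) > 0, i.e., the generalisation curve L is strictly convex at its true minimum. -/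
/-- At any time `t₀` where the weight equals the true weight `z̄ = (1−ρ)σ/λ`,
the second derivative of the generalisation curve equals
`2ρ²σ²(γ²λ² + 4η²σ²(1−ρ)²)/λ`; in particular it is strictly positive whenever
`γ²λ² + 4η²σ²(1−ρ)² > 0`. -/
theorem stmt_13 (lam σ η γ ρ : ℝ) (hlam : 0 < lam) (hσ : 0 < σ) (hη : 0 ≤ η)
    (hρ : ρ ∈ Set.Ioc (0 : ℝ) 1) (zbar : ℝ) (hzbar : zbar = (1 - ρ) * σ / lam)
    (z : ℝ → ℝ) (hz1 : Differentiable ℝ z) (hz2 : Differentiable ℝ (deriv z))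
    (hz : ∀ t, deriv z t = Real.sqrt (γ ^ 2 + 4 * η ^ 2 * z t ^ 2) * (σ - lam * z t))
    (L : ℝ → ℝ) (hL : ∀ t, L t = lam * (zbar - z t) ^ 2)
    (t₀ : ℝ) (ht₀ : z t₀ = zbar) :
    deriv (deriv L) t₀
      = 2 * ρ ^ 2 * σ ^ 2 * (γ ^ 2 * lam ^ 2 + 4 * η ^ 2 * σ ^ 2 * (1 - ρ) ^ 2) / lam
    ∧ (0 < γ ^ 2 * lam ^ 2 + 4 * η ^ 2 * σ ^ 2 * (1 - ρ) ^ 2 →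
        0 < deriv (deriv L) t₀) := by
  obtain ⟨hρ0, hρ1⟩ := hρ
  have hL1 : deriv L = fun t => (-2 * lam) * ((zbar - z t) * deriv z t) := by
    have hLf : L = fun t => lam * (zbar - z t) ^ 2 := funext hL
    funext t
    rw [hLf]
    have h := (((hz1 t).hasDerivAt.const_sub zbar).pow 2).const_mul lam
    refine (HasDerivAt.deriv h).trans ?_
    push_cast
    ring
  have hL2 : deriv (deriv L) t₀ = 2 * lam * (deriv z t₀) ^ 2 := by
    rw [hL1]
    have h := (((hz1 t₀).hasDerivAt.const_sub zbar).mul (hz2 t₀).hasDerivAt).const_mul (-2 * lam)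
    refine (HasDerivAt.deriv h).trans ?_
    rw [ht₀]
    ring
  have key : deriv (deriv L) t₀
      = 2 * ρ ^ 2 * σ ^ 2 * (γ ^ 2 * lam ^ 2 + 4 * η ^ 2 * σ ^ 2 * (1 - ρ) ^ 2) / lam := by
    rw [hL2, hz t₀, mul_pow, Real.sq_sqrt (by positivity), ht₀, hzbar]
    field_simp
    ring
  refine ⟨key, fun h => ?_⟩
  rw [key]
  positivity
end

section
/- Let λ > 0, σ > 0, γ ≠ 0, ρ ∈ (0, 1], 0 ≤ z₀ < σ/λ, and set z̄ := (1 − ρ)·σ/λ. Let z(t) := e^{−|γ|λt}·(z₀ − σ/λ) + σ/λ be the one-layer gradient flow solution and L(t) := λ·(z̄ − z(t))². Define t̂ := log(2(σ − λz₀)/(σρ)) / (|γ|λ). Then z(t̂) = σ(2 − ρ)/(2λ), L''(t) > 0 for all t with z(t) < σ(2 − ρ)/(2λ), L''(t̂) = 0, and L''(t) < 0 for all t with z(t) > σ(2 − ρ)/(2λ); in particular, t̂ is the unique inflection point of L on [0, ∞), and z(t̂) lies strictly between z̄ and σ/λ. -/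
/-- Inflection point of the one-layer generalisation curve: `t̂` is the unique
inflection point of `L(t) = λ(z̄ − z(t))²` for the one-layer flow, with
`z(t̂) = σ(2−ρ)/(2λ)` lying strictly between `z̄` and `σ/λ`. -/
theorem stmt_14 (lam σ γ ρ z₀ : ℝ) (hlam : 0 < lam) (hσ : 0 < σ) (hγ : γ ≠ 0)
    (hρ : ρ ∈ Set.Ioc (0 : ℝ) 1) (hz₀ : 0 ≤ z₀) (hz₀' : z₀ < σ / lam)
    (zbar : ℝ) (hzbar : zbar = (1 - ρ) * σ / lam)
    (z : ℝ → ℝ)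
    (hz : ∀ t, z t = Real.exp (-|γ| * lam * t) * (z₀ - σ / lam) + σ / lam)
    (L : ℝ → ℝ) (hL : ∀ t, L t = lam * (zbar - z t) ^ 2)
    (th : ℝ) (hth : th = Real.log (2 * (σ - lam * z₀) / (σ * ρ)) / (|γ| * lam)) :
    z th = σ * (2 - ρ) / (2 * lam)
    ∧ (∀ t, z t < σ * (2 - ρ) / (2 * lam) → 0 < deriv (deriv L) t)
    ∧ deriv (deriv L) th = 0
    ∧ (∀ t, σ * (2 - ρ) / (2 * lam) < z t → deriv (deriv L) t < 0)
    ∧ zbar < z th ∧ z th < σ / lam := by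
  obtain ⟨hρ0, hρ1⟩ := hρ
  have hg : 0 < |γ| := abs_pos.mpr hγ
  have hzlt : ∀ t, z t < σ / lam := by
    intro t
    rw [hz t]
    have := mul_pos (Real.exp_pos (-|γ| * lam * t)) (sub_pos.mpr hz₀')
    linarith
  have hdz : ∀ t, HasDerivAt z (|γ| * lam * (σ / lam - z t)) t := by
    intro t
    have h1 : HasDerivAt (fun t : ℝ => -|γ| * lam * t) (-|γ| * lam) t := by
      simpa using (hasDerivAt_id t).const_mul (-|γ| * lam)
    have h2 := (h1.exp.mul_const (z₀ - σ / lam)).add_const (σ / lam)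
    have hzf : z = fun t => Real.exp (-|γ| * lam * t) * (z₀ - σ / lam) + σ / lam := funext hz
    rw [hz t, hzf]
    refine h2.congr_deriv ?_
    ring
  have hLf : L = fun t => lam * (zbar - z t) ^ 2 := funext hL
  have hdL : deriv L = fun t => -2 * lam * (|γ| * lam) * ((zbar - z t) * (σ / lam - z t)) := by
    funext t
    have h := (((hdz t).const_sub zbar).pow 2).const_mul lam
    rw [hLf]
    refine HasDerivAt.deriv (h.congr_deriv ?_)
    push_cast
    ring
  have hdd : ∀ t, deriv (deriv L) t
      = 4 * lam * (|γ| * lam) ^ 2 * (σ / lam - z t) * (σ * (2 - ρ) / (2 * lam) - z t) := by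
    intro t
    rw [hdL]
    have h := (((hdz t).const_sub zbar).mul ((hdz t).const_sub (σ / lam))).const_mul
      (-2 * lam * (|γ| * lam))
    refine HasDerivAt.deriv (h.congr_deriv ?_)
    rw [hzbar]
    field_simp
    ring
  have hpos : ∀ t, 0 < 4 * lam * (|γ| * lam) ^ 2 * (σ / lam - z t) := by
    intro t
    have := sub_pos.mpr (hzlt t)
    positivity
  have hd : 0 < σ - lam * z₀ := by
    rw [lt_div_iff₀ hlam] at hz₀'
    linarith
  have hzth : z th = σ * (2 - ρ) / (2 * lam) := by
    have he : -|γ| * lam * th = -Real.log (2 * (σ - lam * z₀) / (σ * ρ)) := by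
      rw [hth]
      field_simp
    rw [hz th, he, Real.exp_neg, Real.exp_log (by positivity)]
    have := hd.ne'
    field_simp
    ring
  refine ⟨hzth, ?_, ?_, ?_, ?_, hzlt th⟩
  · intro t ht
    rw [hdd]
    exact mul_pos (hpos t) (sub_pos.mpr ht)
  · rw [hdd, hzth, sub_self, mul_zero]
  · intro t ht
    rw [hdd]
    exact mul_neg_of_pos_of_neg (hpos t) (sub_neg.mpr ht)
  · rw [hzth, hzbar, div_lt_div_iff₀ hlam (by positivity)]
    have : 0 < σ * ρ * lam := by positivity
    nlinarith
end

section
/- Let λ > 0, σ > 0, η > 0, ρ ∈ (0, 1), 0 < z₀ < σ/λ, and set z̄ := (1 − ρ)·σ/λ. Let z(t) := σ·e^{2ησt}·z₀/(λ(e^{2ησt} − 1)z₀ + σ) be the balanced two-layer gradient flow solution and L(t) := λ·(z̄ − z(t))². Define ẑ^± := σ·(2 − ρ ± √(ρ² − ρ + 1))/(3λ). Then: (a) 0 < ẑ^− < z̄ < ẑ^+ < σ/λ; (b) for all t ≥ 0, L''(t) > 0 if ẑ^− < z(t) < ẑ^+, and L''(t) < 0 if z(t) < ẑ^− or ẑ^+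 < z(t) < σ/λ; (c) if z₀ < ẑ^−, then z(t̂^−) = ẑ^− and z(t̂^+) = ẑ^+ where t̂^± := log((σ − λz₀)(1 ± √(ρ² − ρ + 1))/(λρz₀)) / (2ησ). -/
/-- Inflection points of the balanced two-layer generalisation curve:
the values `ẑ^± = σ(2 − ρ ± √(ρ² − ρ + 1))/(3λ)` separate the convex and concave
regions of `L(t) = λ(z̄ − z(t))²`, and if `z₀ < ẑ⁻` they are attained at the
explicit times `t̂^±`. -/
theorem stmt_15 (lam σ η ρ z₀ : ℝ) (hlam : 0 < lam) (hσ : 0 < σ) (hη : 0 < η)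
    (hρ : ρ ∈ Set.Ioo (0 : ℝ) 1) (hz₀ : 0 < z₀) (hz₀' : z₀ < σ / lam)
    (zbar : ℝ) (hzbar : zbar = (1 - ρ) * σ / lam)
    (z : ℝ → ℝ)
    (hz : ∀ t, z t = σ * Real.exp (2 * η * σ * t) * z₀
      / (lam * (Real.exp (2 * η * σ * t) - 1) * z₀ + σ))
    (L : ℝ → ℝ) (hL : ∀ t, L t = lam * (zbar - z t) ^ 2)
    (zm zp : ℝ)
    (hzm : zm = σ * (2 - ρ - Real.sqrt (ρ ^ 2 - ρ + 1)) / (3 * lam))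
    (hzp : zp = σ * (2 - ρ + Real.sqrt (ρ ^ 2 - ρ + 1)) / (3 * lam)) :
    (0 < zm ∧ zm < zbar ∧ zbar < zp ∧ zp < σ / lam)
    ∧ (∀ t ≥ (0 : ℝ),
        (zm < z t ∧ z t < zp → 0 < deriv (deriv L) t)
        ∧ (z t < zm → deriv (deriv L) t < 0)
        ∧ (zp < z t ∧ z t < σ / lam → deriv (deriv L) t < 0))
    ∧ (z₀ < zm →
        z (Real.log ((σ - lam * z₀) * (1 - Real.sqrt (ρ ^ 2 - ρ + 1))
              / (lam * ρ * z₀)) / (2 * η * σ)) = zm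
        ∧ z (Real.log ((σ - lam * z₀) * (1 + Real.sqrt (ρ ^ 2 - ρ + 1))
              / (lam * ρ * z₀)) / (2 * η * σ)) = zp) := by
  obtain ⟨hρ0, hρ1⟩ := hρ
  set s := Real.sqrt (ρ ^ 2 - ρ + 1) with hs
  have hs2 : s ^ 2 = ρ ^ 2 - ρ + 1 := Real.sq_sqrt (by nlinarith)
  have hs0 : 0 ≤ s := Real.sqrt_nonneg _
  have hρρ : 0 < ρ * (1 - ρ) := mul_pos hρ0 (by linarith)
  have hs1 : s < 1 := by nlinarith
  have hsa : 2 * ρ - 1 < s := lt_of_pow_lt_pow_left₀ 2 hs0 (by nlinarith)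
  have hsb : 1 - 2 * ρ < s := lt_of_pow_lt_pow_left₀ 2 hs0 (by nlinarith)
  have hw : 0 < σ - lam * z₀ := by
    rw [lt_div_iff₀ hlam] at hz₀'; linarith
  have hden : ∀ t, 0 < lam * (Real.exp (2 * η * σ * t) - 1) * z₀ + σ := by
    intro t
    have : 0 < lam * Real.exp (2 * η * σ * t) * z₀ := by positivity
    nlinarith
  have hzpos : ∀ t, 0 < z t := by
    intro t
    rw [hz]
    have := hden t
    positivity
  have hzlt : ∀ t, 0 < σ - lam * z t := by
    intro t
    have h := hden t
    have : σ - lam * z t = σ * (σ - lam * z₀) /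
        (lam * (Real.exp (2 * η * σ * t) - 1) * z₀ + σ) := by
      rw [hz, eq_div_iff h.ne', sub_mul, mul_assoc lam (_ / _), div_mul_cancel₀ _ h.ne']
      ring
    rw [this]
    positivity
  have hzd : ∀ t, HasDerivAt z (2 * η * z t * (σ - lam * z t)) t := by
    intro t
    have h := hden t
    have he : HasDerivAt (fun t => Real.exp (2 * η * σ * t))
        (Real.exp (2 * η * σ * t) * (2 * η * σ)) t := by
      simpa using ((hasDerivAt_id t).const_mul (2 * η * σ)).exp
    have hq := ((he.const_mul σ).mul_const z₀).div
      ((((he.sub_const 1).const_mul lam).mul_const z₀).add_const σ) h.ne'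
    have hzf : z = fun t => σ * Real.exp (2 * η * σ * t) * z₀
      / (lam * (Real.exp (2 * η * σ * t) - 1) * z₀ + σ) := funext hz
    have hq' := hq.congr_of_eventuallyEq (f₁ := z) (Filter.Eventually.of_forall hz)
    refine hq'.congr_deriv ?_
    rw [hz]
    generalize Real.exp (2 * η * σ * t) = E at h ⊢
    generalize lam * (E - 1) * z₀ + σ = D at h ⊢
    have h' := h.ne'
    field_simp
  have hLd : ∀ t, HasDerivAt L
      (-(4 * η * lam) * ((zbar - z t) * z t * (σ - lam * z t))) t := by
    intro t
    have h := (((hzd t).const_sub zbar).pow 2).const_mul lam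
    refine (h.congr_of_eventuallyEq (f₁ := L) (Filter.Eventually.of_forall hL)).congr_deriv ?_
    push_cast
    ring
  have hdL : deriv L = fun t => -(4 * η * lam) * ((zbar - z t) * z t * (σ - lam * z t)) :=
    funext fun t => (hLd t).deriv
  have hddL : ∀ t, deriv (deriv L) t =
      -(24 * η ^ 2 * lam ^ 2 * z t * (σ - lam * z t)) * ((z t - zm) * (z t - zp)) := by
    intro t
    have h := ((((hzd t).const_sub zbar).mul (hzd t)).mul
      (((hzd t).const_mul lam).const_sub σ)).const_mul (-(4 * η * lam))
    have hvieta : (z t - zm) * (z t - zp) * (3 * lam) =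
        3 * lam * z t ^ 2 - 2 * (σ + lam * zbar) * z t + zbar * σ := by
      rw [hzm, hzp, hzbar]
      field_simp
      linear_combination (-σ ^ 2) * hs2
    rw [hdL]
    refine h.deriv.trans ?_
    simp only [Pi.mul_apply]
    linear_combination (8 * η ^ 2 * lam * z t * (σ - lam * z t)) * hvieta
  have hmp : zm < zp := by
    rw [hzm, hzp]
    gcongr
    nlinarith
  refine ⟨⟨?_, ?_, ?_, ?_⟩, ?_, ?_⟩
  · rw [hzm]
    have : 0 < 2 - ρ - s := by linarith
    positivity
  · rw [hzm, hzbar, div_lt_div_iff₀ (by positivity) hlam]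
    have : 0 < σ * lam * (s - (2 * ρ - 1)) := mul_pos (by positivity) (by linarith)
    nlinarith
  · rw [hzp, hzbar, div_lt_div_iff₀ hlam (by positivity)]
    have : 0 < σ * lam * (s - (1 - 2 * ρ)) := mul_pos (by positivity) (by linarith)
    nlinarith
  · rw [hzp, div_lt_div_iff₀ (by positivity) hlam]
    have : 0 < σ * lam * (1 + ρ - s) := mul_pos (by positivity) (by linarith)
    nlinarith
  · intro t _
    have h1 := hzpos t
    have h2 := hzlt t
    have hc : 0 < 24 * η ^ 2 * lam ^ 2 * z t * (σ - lam * z t) := by positivity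
    rw [hddL]
    refine ⟨fun h => ?_, fun h => ?_, fun h => ?_⟩
    · exact mul_pos_of_neg_of_neg (by linarith)
        (mul_neg_of_pos_of_neg (by linarith [h.1]) (by linarith [h.2]))
    · exact mul_neg_of_neg_of_pos (by linarith)
        (mul_pos_of_neg_of_neg (by linarith) (by linarith))
    · exact mul_neg_of_neg_of_pos (by linarith)
        (mul_pos (by linarith [h.1]) (by linarith [h.1]))
  · intro _
    have key : ∀ r : ℝ, r ^ 2 = ρ ^ 2 - ρ + 1 → 0 < 1 + r →
        z (Real.log ((σ - lam * z₀) * (1 + r) / (lam * ρ * z₀)) / (2 * η * σ))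
          = σ * (2 - ρ + r) / (3 * lam) := by
      intro r hr hr0
      have hx : 0 < (σ - lam * z₀) * (1 + r) / (lam * ρ * z₀) := by positivity
      have h := hden (Real.log ((σ - lam * z₀) * (1 + r) / (lam * ρ * z₀)) / (2 * η * σ))
      rw [hz]
      rw [mul_div_cancel₀ _ (by positivity : 2 * η * σ ≠ 0), Real.exp_log hx] at h ⊢
      rw [div_eq_div_iff h.ne' (by positivity)]
      field_simp
      linear_combination -(σ - lam * z₀) * hr
    constructor
    · have := key (-s) (by rw [neg_sq, hs2]) (by linarith)
      rw [hzm]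
      simpa only [← sub_eq_add_neg] using this
    · rw [hzp]
      exact key s hs2 (by linarith)
end

section
/- Let I be a finite nonempty index set, let L_i : ℝ → ℝ (i ∈ I) be twice differentiable functions, and let 0 ≤ m ≤ M be real numbers such that for every i ∈ I: L_i'(t) ≤ 0 for all t ∈ [0, m], L_i''(t) ≥ 0 for all t ∈ [m, M], and L_i'(t) ≥ 0 for all t ∈ [M, ∞). Define L := Σ_{i ∈ I} L_i. Then for all 0 ≤ t' ≤ t'', if L'(t') > 0 then L'(t'') ≥ 0. In particular, L exhibits no epoch-wise double descent: there is no interval on which L is strictly increasing followed by a later interval on which L is strictly decreasing. -/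
/-- Analytic core of the necessary condition for epoch-wise double descent: if each
curve `L i` is nonincreasing on `[0, m]`, convex on `[m, M]` and nondecreasing on
`[M, ∞)`, then once the total error `L = Σ_i L i` is strictly increasing at some
time `t'`, its derivative stays nonnegative at every later time `t''`; i.e. no
double descent. -/
theorem stmt_16 {I : Type*} [Fintype I] [Nonempty I]
    (L : I → ℝ → ℝ)
    (hdiff : ∀ i, Differentiable ℝ (L i))
    (hdiff2 : ∀ i, Differentiable ℝ (deriv (L i)))
    (m M : ℝ) (hm : 0 ≤ m) (hmM : m ≤ M)
    (h1 : ∀ i, ∀ t ∈ Set.Icc (0 : ℝ) m, deriv (L i) t ≤ 0)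
    (h2 : ∀ i, ∀ t ∈ Set.Icc m M, 0 ≤ deriv (deriv (L i)) t)
    (h3 : ∀ i, ∀ t ∈ Set.Ici M, 0 ≤ deriv (L i) t) :
    ∀ t' t'' : ℝ, 0 ≤ t' → t' ≤ t'' →
      0 < deriv (fun t => ∑ i, L i t) t' →
      0 ≤ deriv (fun t => ∑ i, L i t) t'' := by
  intro t' t'' h0 hle hpos
  have hd : ∀ t, deriv (fun t => ∑ i, L i t) t = ∑ i, deriv (L i) t := by
    intro t
    exact deriv_fun_sum (fun i _ => hdiff i t)
  rw [hd] at hpos ⊢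
  have hmt : m < t' := by
    by_contra! hc
    have : ∑ i, deriv (L i) t' ≤ 0 :=
      Finset.sum_nonpos (fun i _ => h1 i t' ⟨h0, hc⟩)
    linarith
  rcases le_total M t'' with hM | hM
  · exact Finset.sum_nonneg (fun i _ => h3 i t'' hM)
  · refine hpos.le.trans (Finset.sum_le_sum fun i _ => ?_)
    have hmono : MonotoneOn (deriv (L i)) (Set.Icc m M) := by
      apply monotoneOn_of_deriv_nonneg (convex_Icc m M)
        (hdiff2 i).continuous.continuousOn (hdiff2 i).differentiableOn
      intro x hx
      exact h2 i x (interior_subset hx)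
    exact hmono ⟨hmt.le, hle.trans hM⟩ ⟨hmt.le.trans hle, hM⟩ hle
end

section
/- Let λ > 0, σ > 0, η ≥ 0, γ ∈ ℝ with γ² + η² > 0, ρ ∈ (0, 1), and z₀ ∈ ℝ with 0 ≤ z₀ < (1 − ρ)·σ/λ, and additionally z₀ > 0 if γ = 0. Set μ := √(γ²λ² + 4η²σ²), C := (√((γ²λ² + 4η²σ²)(γ² + 4η²z₀²)) + γ²λ + 4η²σz₀)/(λ(σ − λz₀)), and let z : ℝ → ℝ be the explicit solution z(t) = (C²λ²σ·e^{2μt} − 2Cγ²λ²·e^{μt} − 4γ²η²σ)/(λ(C²λ²·e^{2μt} + 8Cη²σ·e^{μt} − 4γ²η²)) of the bridged gradient flow. Define t̂ := log( (√((γ²λ² + 4η²σ²)(γ²λ² + 4η²σ²(1−ρ)²)) + γ²λ² + 4η²σ²(1−ρ)) / (C·λ²·σ·ρ) ) / μ. Then z(t̂) = (1 − ρ)·σ/λ; i.e., t̂ is the time at which the weight reaches its true minimum (1 − ρ)·σ/λ. -/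
/-- The explicit solution of the bridged gradient flow reaches the true weight
`(1 − ρ)σ/λ` exactly at the time `t̂` given by the closed-form expression. -/
theorem stmt_17 (lam σ η γ ρ z₀ μ C : ℝ) (hlam : 0 < lam) (hσ : 0 < σ) (hη : 0 ≤ η)
    (hγη : 0 < γ ^ 2 + η ^ 2) (hρ : ρ ∈ Set.Ioo (0 : ℝ) 1)
    (hz₀ : 0 ≤ z₀) (hz₀' : z₀ < (1 - ρ) * σ / lam) (hz₀γ : γ = 0 → 0 < z₀)
    (hμ : μ = Real.sqrt (γ ^ 2 * lam ^ 2 + 4 * η ^ 2 * σ ^ 2))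
    (hC : C = (Real.sqrt ((γ ^ 2 * lam ^ 2 + 4 * η ^ 2 * σ ^ 2)
          * (γ ^ 2 + 4 * η ^ 2 * z₀ ^ 2))
        + γ ^ 2 * lam + 4 * η ^ 2 * σ * z₀) / (lam * (σ - lam * z₀)))
    (z : ℝ → ℝ)
    (hz : ∀ t, z t = (C ^ 2 * lam ^ 2 * σ * Real.exp (2 * μ * t)
        - 2 * C * γ ^ 2 * lam ^ 2 * Real.exp (μ * t) - 4 * γ ^ 2 * η ^ 2 * σ)
      / (lam * (C ^ 2 * lam ^ 2 * Real.exp (2 * μ * t)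
        + 8 * C * η ^ 2 * σ * Real.exp (μ * t) - 4 * γ ^ 2 * η ^ 2)))
    (th : ℝ)
    (hth : th = Real.log ((Real.sqrt ((γ ^ 2 * lam ^ 2 + 4 * η ^ 2 * σ ^ 2)
          * (γ ^ 2 * lam ^ 2 + 4 * η ^ 2 * σ ^ 2 * (1 - ρ) ^ 2))
        + γ ^ 2 * lam ^ 2 + 4 * η ^ 2 * σ ^ 2 * (1 - ρ))
        / (C * lam ^ 2 * σ * ρ)) / μ) :
    z th = (1 - ρ) * σ / lam := by
  obtain ⟨hρ0, hρ1⟩ := hρ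
  have h1ρ : 0 < 1 - ρ := by linarith
  have hcase : 0 < γ ^ 2 ∨ (γ = 0 ∧ 0 < η ^ 2) := by
    by_cases h : γ = 0
    · right
      refine ⟨h, ?_⟩
      simpa [h] using hγη
    · left
      positivity
  have hM : 0 < γ ^ 2 * lam ^ 2 + 4 * η ^ 2 * σ ^ 2 := by
    rcases hcase with h | ⟨_, h⟩ <;> positivity
  have hμ0 : 0 < μ := by rw [hμ]; exact Real.sqrt_pos.mpr hM
  have hlz : lam * z₀ < σ := by
    rw [lt_div_iff₀ hlam] at hz₀'
    nlinarith [mul_pos hρ0 hσ]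
  have hden : 0 < lam * (σ - lam * z₀) := mul_pos hlam (by linarith)
  have hC0 : 0 < C := by
    rw [hC]
    apply div_pos _ hden
    rcases hcase with h | ⟨h0, h⟩
    · positivity
    · have := hz₀γ h0
      positivity
  set S := Real.sqrt ((γ ^ 2 * lam ^ 2 + 4 * η ^ 2 * σ ^ 2)
          * (γ ^ 2 * lam ^ 2 + 4 * η ^ 2 * σ ^ 2 * (1 - ρ) ^ 2)) with hS
  have hS0 : 0 ≤ S := Real.sqrt_nonneg _
  have hS2 : S ^ 2 = (γ ^ 2 * lam ^ 2 + 4 * η ^ 2 * σ ^ 2)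
          * (γ ^ 2 * lam ^ 2 + 4 * η ^ 2 * σ ^ 2 * (1 - ρ) ^ 2) :=
    Real.sq_sqrt (by positivity)
  have hN : 0 < S + γ ^ 2 * lam ^ 2 + 4 * η ^ 2 * σ ^ 2 * (1 - ρ) := by
    rcases hcase with h | ⟨_, h⟩ <;> positivity
  have hE : Real.exp (μ * th) = (S + γ ^ 2 * lam ^ 2 + 4 * η ^ 2 * σ ^ 2 * (1 - ρ))
        / (C * lam ^ 2 * σ * ρ) := by
    rw [hth, mul_div_cancel₀ _ hμ0.ne', Real.exp_log (by positivity)]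
  have hE2 : Real.exp (2 * μ * th) = Real.exp (μ * th) ^ 2 := by
    rw [← Real.exp_nat_mul]; congr 1; push_cast; ring
  have hEpos := Real.exp_pos (μ * th)
  rw [hz, hE2]
  set E := Real.exp (μ * th)
  have hX0 : 0 < C * E := mul_pos hC0 hEpos
  have hX : ρ * lam ^ 2 * σ * (C * E)
      = S + γ ^ 2 * lam ^ 2 + 4 * η ^ 2 * σ ^ 2 * (1 - ρ) := by
    rw [hE]; field_simp
  have hSX : S = ρ * lam ^ 2 * σ * (C * E)
      - (γ ^ 2 * lam ^ 2 + 4 * η ^ 2 * σ ^ 2 * (1 - ρ)) := by linarith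
  have key : C ^ 2 * lam ^ 2 * σ * E ^ 2 - 2 * C * γ ^ 2 * lam ^ 2 * E - 4 * γ ^ 2 * η ^ 2 * σ
      = (1 - ρ) * σ * (C ^ 2 * lam ^ 2 * E ^ 2 + 8 * C * η ^ 2 * σ * E - 4 * γ ^ 2 * η ^ 2) := by
    have hk : ρ * lam ^ 2 * σ ≠ 0 := by positivity
    apply mul_left_cancel₀ hk
    rw [hSX] at hS2
    linear_combination hS2
  have hD : C ^ 2 * lam ^ 2 * E ^ 2 + 8 * C * η ^ 2 * σ * E - 4 * γ ^ 2 * η ^ 2 ≠ 0 := by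
    intro h
    rw [h] at key
    have h2 : (C * E) * (γ ^ 2 * lam ^ 2 + 4 * η ^ 2 * σ ^ 2) = 0 := by
      linear_combination (σ * h - key) / 2
    exact (mul_pos hX0 hM).ne' h2
  rw [key, mul_comm lam, ← div_div, mul_div_cancel_right₀ _ hD]
end
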